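/- arXiv:0906.2330 — 3 statements merged into one kernel-verified Lean document; each statement's English description precedes it below -/
import Mathlib

section
/- For every natural number k ≥ 1, in the group algebra ℚ[S_{k+1}] one has the recursion A_{k+1} = (1/(k+1)) • (A_k * (1 − k • t_{k,k+1}) * A_k), where A_j denotes the partial antisymmetrizer and t_{k,k+1} the transposition of the last two points. (Here 1 − k • t_{k,k+1} is the Yang R-matrix R_{k,k+1}(1/k) for R(u) = 1 − P/u.) -/
/-- The partial antisymmetrizer `A_j` in the group algebra `ℚ[S_N]`:
`(1/j!) Σ_σ sgn(σ) • σ`, the sum over all permutations of `Fin N` fixing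
every point outside the first `j` points (0-based indices `≥ j`). -/
noncomputable def antisymmetrizer (N j : ℕ) : MonoidAlgebra ℚ (Equiv.Perm (Fin N)) :=
  ((j.factorial : ℚ))⁻¹ •
    ∑ σ ∈ Finset.univ.filter
        (fun σ : Equiv.Perm (Fin N) => ∀ i : Fin N, j ≤ (i : ℕ) → σ i = i),
      ((Equiv.Perm.sign σ : ℤ) : ℚ) • MonoidAlgebra.of ℚ (Equiv.Perm (Fin N)) σ

open Equiv MonoidAlgebra

theorem of_mul_antisymmetrizer {N j : ℕ} {τ : Perm (Fin N)}
    (hτ : ∀ i : Fin N, j ≤ (i : ℕ) → τ i = i) :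
    of ℚ (Perm (Fin N)) τ * antisymmetrizer N j =
      ((Perm.sign τ : ℤ) : ℚ) • antisymmetrizer N j := by
  unfold antisymmetrizer
  rw [mul_smul_comm, smul_comm, Finset.mul_sum]
  congr 1
  rw [Finset.smul_sum]
  refine Finset.sum_equiv (Equiv.mulLeft τ) (fun σ => ?_) (fun σ _ => ?_)
  · simp only [Finset.mem_filter, Finset.mem_univ, true_and, Equiv.coe_mulLeft, Perm.mul_apply]
    refine forall₂_congr fun i hi => ?_
    rw [← τ.injective.eq_iff (a := σ i), hτ i hi]
  · rw [mul_smul_comm, ← map_mul, smul_smul, Equiv.coe_mulLeft, Perm.sign_mul]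
    congr 1
    rcases Int.units_eq_one_or (Perm.sign τ) with h | h <;> simp [h]

theorem antisymmetrizer_mul_of {N j : ℕ} {τ : Perm (Fin N)}
    (hτ : ∀ i : Fin N, j ≤ (i : ℕ) → τ i = i) :
    antisymmetrizer N j * of ℚ (Perm (Fin N)) τ =
      ((Perm.sign τ : ℤ) : ℚ) • antisymmetrizer N j := by
  unfold antisymmetrizer
  rw [smul_mul_assoc, smul_comm, Finset.sum_mul]
  congr 1
  rw [Finset.smul_sum]
  refine Finset.sum_equiv (Equiv.mulRight τ) (fun σ => ?_) (fun σ _ => ?_)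
  · simp only [Finset.mem_filter, Finset.mem_univ, true_and, Equiv.coe_mulRight, Perm.mul_apply]
    refine forall₂_congr fun i hi => ?_
    rw [hτ i hi]
  · rw [smul_mul_assoc, ← map_mul, smul_smul, Equiv.coe_mulRight, Perm.sign_mul]
    congr 1
    rcases Int.units_eq_one_or (Perm.sign τ) with h | h <;> simp [h]

theorem card_perm_fixing_ge {N j : ℕ} (hj : j ≤ N) :
    (Finset.univ.filter
      (fun σ : Perm (Fin N) => ∀ i : Fin N, j ≤ (i : ℕ) → σ i = i)).card = j.factorial := by
  have hcard : Fintype.card {i : Fin N // (i : ℕ) < j} = j := by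
    rw [Fintype.card_congr (Fin.castLEquiv hj).symm, Fintype.card_fin]
  rw [← Fintype.card_subtype, ← hcard, ← Fintype.card_perm,
    Fintype.card_congr (Perm.subtypeEquivSubtypePerm fun i : Fin N => (i : ℕ) < j)]
  simp only [not_lt, hcard]

theorem antisymmetrizer_mul_antisymmetrizer {N j l : ℕ} (hj : j ≤ N) (hjl : j ≤ l) :
    antisymmetrizer N j * antisymmetrizer N l = antisymmetrizer N l := by
  conv_lhs => rw [antisymmetrizer]
  rw [smul_mul_assoc, Finset.sum_mul]
  have hterm : ∀ σ ∈ Finset.univ.filter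
      (fun σ : Perm (Fin N) => ∀ i : Fin N, j ≤ (i : ℕ) → σ i = i),
      ((Perm.sign σ : ℤ) : ℚ) • of ℚ (Perm (Fin N)) σ * antisymmetrizer N l =
        antisymmetrizer N l := fun σ hσ => by
    rw [smul_mul_assoc,
      of_mul_antisymmetrizer fun i hi => (Finset.mem_filter.mp hσ).2 i (hjl.trans hi), smul_smul]
    rcases Int.units_eq_one_or (Perm.sign σ) with h | h <;> simp [h]
  rw [Finset.sum_congr rfl hterm, Finset.sum_const, card_perm_fixing_ge hj,
    ← Nat.cast_smul_eq_nsmul ℚ, smul_smul,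
    inv_mul_cancel₀ (Nat.cast_ne_zero.mpr j.factorial_ne_zero), one_smul]

/-- Left coset decomposition of `A_{k+1}` along the stabilizer of the last point. -/
theorem antisymmetrizer_succ_eq_sum_swap (k : ℕ) :
    antisymmetrizer (k + 1) (k + 1) = (k + 1 : ℚ)⁻¹ • ∑ i : Fin (k + 1),
      ((Perm.sign (swap i (Fin.last k)) : ℤ) : ℚ) •
        (of ℚ (Perm (Fin (k + 1))) (swap i (Fin.last k)) * antisymmetrizer (k + 1) k) := by
  have hall : (Finset.univ.filter
      (fun σ : Perm (Fin (k + 1)) => ∀ i : Fin (k + 1), k + 1 ≤ (i : ℕ) → σ i = i)) =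
      Finset.univ :=
    Finset.filter_true_of_mem fun σ _ i hi => absurd i.isLt (by omega)
  unfold antisymmetrizer
  rw [hall, Nat.factorial_succ, Nat.cast_mul, mul_inv, ← smul_smul, Nat.cast_succ,
    ← Finset.sum_fiberwise Finset.univ (fun σ : Perm (Fin (k + 1)) => σ (Fin.last k)),
    Finset.smul_sum]
  congr 1
  refine Finset.sum_congr rfl fun i _ => ?_
  rw [mul_smul_comm, smul_comm, Finset.mul_sum]
  congr 1
  rw [Finset.smul_sum]
  symm
  refine Finset.sum_equiv (Equiv.mulLeft (swap i (Fin.last k))) (fun σ => ?_) (fun σ _ => ?_)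
  · simp only [Finset.mem_filter, Finset.mem_univ, true_and, Equiv.coe_mulLeft, Perm.mul_apply]
    rw [← Equiv.eq_symm_apply, symm_swap, swap_apply_left]
    refine ⟨fun h => h _ le_rfl, fun h l hl => ?_⟩
    obtain rfl : l = Fin.last k := Fin.ext (by have := l.isLt; simp; omega)
    exact h
  · rw [mul_smul_comm, ← map_mul, smul_smul, Equiv.coe_mulLeft, Perm.sign_mul]
    push_cast
    rfl

/-- All transpositions moving the last point agree when sandwiched between copies of `A_k`. -/
theorem antisymmetrizer_mul_swap_last_mul {k : ℕ} {i j : Fin (k + 1)}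
    (hi : i ≠ Fin.last k) (hj : j ≠ Fin.last k) :
    antisymmetrizer (k + 1) k * of ℚ (Perm (Fin (k + 1))) (swap i (Fin.last k)) *
        antisymmetrizer (k + 1) k =
      antisymmetrizer (k + 1) k * of ℚ (Perm (Fin (k + 1))) (swap j (Fin.last k)) *
        antisymmetrizer (k + 1) k := by
  have hfix : ∀ l : Fin (k + 1), k ≤ (l : ℕ) → swap i j l = l := fun l hl => by
    obtain rfl : l = Fin.last k := Fin.ext (by have := l.isLt; simp; omega)
    exact swap_apply_of_ne_of_ne hi.symm hj.symm
  have hconj : swap i (Fin.last k) = swap i j * swap j (Fin.last k) * swap i j := by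
    have := swap_apply_apply (swap i j) j (Fin.last k)
    rwa [swap_apply_right, hfix _ le_rfl, swap_inv] at this
  rw [hconj, map_mul, map_mul, ← mul_assoc, ← mul_assoc, antisymmetrizer_mul_of hfix,
    mul_assoc _ (of ℚ _ (swap i j)), of_mul_antisymmetrizer hfix, smul_mul_assoc, smul_mul_assoc,
    mul_smul_comm, smul_smul]
  rcases Int.units_eq_one_or (Perm.sign (swap i j)) with h | h <;> simp [h]

/-- `A_{k+1} = (1/(k+1)) • (A_k * (1 − k • t_{k,k+1}) * A_k)` in `ℚ[S_{k+1}]`,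
where `t_{k,k+1}` is the transposition of the last two points (1-based labels
`k` and `k+1`, i.e. 0-based indices `k-1` and `k`). -/
theorem antisymmetrizer_recursion (k : ℕ) (hk : 1 ≤ k) :
    antisymmetrizer (k + 1) (k + 1) =
      ((k + 1 : ℚ))⁻¹ •
        (antisymmetrizer (k + 1) k *
          ((1 : MonoidAlgebra ℚ (Equiv.Perm (Fin (k + 1)))) -
            (k : ℚ) • MonoidAlgebra.of ℚ (Equiv.Perm (Fin (k + 1)))
              (Equiv.swap ⟨k - 1, by omega⟩ ⟨k, by omega⟩)) *
          antisymmetrizer (k + 1) k) := by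
  have hlast : (⟨k, by omega⟩ : Fin (k + 1)) = Fin.last k := rfl
  have hne : (⟨k - 1, by omega⟩ : Fin (k + 1)) ≠ Fin.last k := by
    simp only [ne_eq, Fin.ext_iff, Fin.val_last]
    omega
  rw [hlast, ← antisymmetrizer_mul_antisymmetrizer (N := k + 1) k.le_succ k.le_succ,
    antisymmetrizer_succ_eq_sum_swap, mul_smul_comm, Finset.mul_sum, Fin.sum_univ_castSucc]
  congr 1
  have hterm : ∀ i : Fin k, antisymmetrizer (k + 1) k *
      (((Perm.sign (swap i.castSucc (Fin.last k)) : ℤ) : ℚ) •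
        (of ℚ (Perm (Fin (k + 1))) (swap i.castSucc (Fin.last k)) *
          antisymmetrizer (k + 1) k)) =
      -(antisymmetrizer (k + 1) k *
        of ℚ (Perm (Fin (k + 1))) (swap ⟨k - 1, by omega⟩ (Fin.last k)) *
          antisymmetrizer (k + 1) k) := fun i => by
    rw [mul_smul_comm, ← mul_assoc,
      antisymmetrizer_mul_swap_last_mul (Fin.castSucc_ne_last i) hne,
      Perm.sign_swap (Fin.castSucc_ne_last i)]
    simp
  rw [Finset.sum_congr rfl fun i _ => hterm i, Finset.sum_const, Finset.card_univ,
    Fintype.card_fin, swap_self, ← Perm.one_def, map_one, map_one, one_mul, mul_sub, sub_mul,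
    mul_one, mul_smul_comm (k : ℚ), smul_mul_assoc, Nat.cast_smul_eq_nsmul, smul_neg]
  simp [sub_eq_neg_add]
end

section
/- For every natural number k ≥ 1, in the group algebra ℚ[S_{k+1}] one has the recursion S_{k+1} = (1/(k+1)) • (S_k * (1 + k • t_{k,k+1}) * S_k), where S_j denotes the partial symmetrizer and t_{k,k+1} the transposition of the last two points. (Here 1 + k • t_{k,k+1} is the Yang R-matrix R_{k,k+1}(−1/k) for R(u) = 1 − P/u.) -/
/-- The partial symmetrizer `A_j` in the group algebra `ℚ[S_N]`:
`(1/j!) Σ_σ σ`, the sum over all permutations of `Fin N` fixing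
every point outside the first `j` points (0-based indices `≥ j`). -/
noncomputable def symmetrizer (N j : ℕ) : MonoidAlgebra ℚ (Equiv.Perm (Fin N)) :=
  ((j.factorial : ℚ))⁻¹ •
    ∑ σ ∈ Finset.univ.filter
        (fun σ : Equiv.Perm (Fin N) => ∀ i : Fin N, j ≤ (i : ℕ) → σ i = i),
      MonoidAlgebra.of ℚ (Equiv.Perm (Fin N)) σ

open Equiv in
/-- Coset decomposition of the symmetric group along the stabilizer of the last point. -/
theorem sum_perm_eq_sum_swap_mul_stabilizer {M : Type*} [AddCommMonoid M] (k : ℕ)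
    (f : Perm (Fin (k + 1)) → M) :
    ∑ σ, f σ = ∑ i, ∑ σ ∈ Finset.univ.filter
        (fun σ : Perm (Fin (k + 1)) => ∀ i : Fin (k + 1), k ≤ (i : ℕ) → σ i = i),
      f (swap i (Fin.last k) * σ) := by
  have fix_iff (σ : Perm (Fin (k + 1))) :
      (∀ i : Fin (k + 1), k ≤ (i : ℕ) → σ i = i) ↔ σ (Fin.last k) = Fin.last k := by
    refine ⟨fun h => h _ le_rfl, fun h i hi => ?_⟩
    obtain rfl : i = Fin.last k := Fin.ext (by have := i.isLt; simp; omega)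
    exact h
  simp only [fix_iff]
  rw [← Finset.sum_fiberwise Finset.univ (fun σ : Perm (Fin (k + 1)) => σ (Fin.last k))]
  refine Finset.sum_congr rfl fun i _ => ?_
  refine Finset.sum_nbij' (fun σ => swap i (Fin.last k) * σ)
    (fun σ => swap i (Fin.last k) * σ) ?_ ?_ ?_ ?_ ?_
  · simp +contextual
  · simp +contextual
  · simp
  · simp
  · simp

/-- The number of permutations fixing the last point. -/
theorem card_perm_fixing_last (k : ℕ) :
    (Finset.univ.filter (fun σ : Equiv.Perm (Fin (k + 1)) =>
      ∀ i : Fin (k + 1), k ≤ (i : ℕ) → σ i = i)).card = k.factorial := by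
  have h := sum_perm_eq_sum_swap_mul_stabilizer k (fun _ => 1)
  simp only [Finset.sum_const, Finset.card_univ, Fintype.card_perm, Fintype.card_fin,
    smul_eq_mul, mul_one, Nat.factorial_succ] at h
  exact (Nat.eq_of_mul_eq_mul_left k.succ_pos h).symm

theorem of_mul_symmetrizer {N j : ℕ} {τ : Equiv.Perm (Fin N)}
    (hτ : ∀ i : Fin N, j ≤ (i : ℕ) → τ i = i) :
    MonoidAlgebra.of ℚ _ τ * symmetrizer N j = symmetrizer N j := by
  have hτ' : ∀ i : Fin N, j ≤ (i : ℕ) → τ.symm i = i := fun i hi => by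
    rw [Equiv.symm_apply_eq, hτ i hi]
  unfold symmetrizer
  rw [mul_smul_comm, Finset.mul_sum]
  congr 1
  refine Finset.sum_nbij' (fun σ => τ * σ) (fun σ => τ⁻¹ * σ) ?_ ?_ ?_ ?_ ?_
  · simp +contextual [hτ]
  · simp +contextual [hτ']
  · simp
  · simp
  · simp only [map_mul, implies_true]

theorem symmetrizer_mul_of {N j : ℕ} {τ : Equiv.Perm (Fin N)}
    (hτ : ∀ i : Fin N, j ≤ (i : ℕ) → τ i = i) :
    symmetrizer N j * MonoidAlgebra.of ℚ _ τ = symmetrizer N j := by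
  have hτ' : ∀ i : Fin N, j ≤ (i : ℕ) → τ.symm i = i := fun i hi => by
    rw [Equiv.symm_apply_eq, hτ i hi]
  unfold symmetrizer
  rw [smul_mul_assoc, Finset.sum_mul]
  congr 1
  refine Finset.sum_nbij' (fun σ => σ * τ) (fun σ => σ * τ⁻¹) ?_ ?_ ?_ ?_ ?_
  · simp +contextual [hτ]
  · simp +contextual [hτ']
  · simp
  · simp
  · simp only [map_mul, implies_true]

/-- The full symmetrizer absorbs the symmetrizer of the stabilizer of the last point. -/
theorem symmetrizer_mul_symmetrizer_succ (k : ℕ) :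
    symmetrizer (k + 1) k * symmetrizer (k + 1) (k + 1) = symmetrizer (k + 1) (k + 1) := by
  have absorb (τ : Equiv.Perm (Fin (k + 1))) : MonoidAlgebra.of ℚ _ τ *
      symmetrizer (k + 1) (k + 1) = symmetrizer (k + 1) (k + 1) :=
    of_mul_symmetrizer fun i hi => absurd i.isLt (by omega)
  conv_lhs => enter [1]; unfold symmetrizer
  rw [smul_mul_assoc, Finset.sum_mul, Finset.sum_congr rfl fun τ _ => absorb τ,
    Finset.sum_const, card_perm_fixing_last, ← Nat.cast_smul_eq_nsmul ℚ, smul_smul,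
    inv_mul_cancel₀ (Nat.cast_ne_zero.2 k.factorial_ne_zero), one_smul]

theorem symmetrizer_succ_eq_sum_swap_mul (k : ℕ) :
    symmetrizer (k + 1) (k + 1) = ((k + 1 : ℚ))⁻¹ •
      ∑ i, MonoidAlgebra.of ℚ _ (Equiv.swap i (Fin.last k)) * symmetrizer (k + 1) k := by
  have filter_univ : Finset.univ.filter (fun σ : Equiv.Perm (Fin (k + 1)) =>
      ∀ i : Fin (k + 1), k + 1 ≤ (i : ℕ) → σ i = i) = Finset.univ :=
    Finset.filter_true_of_mem fun σ _ i hi => absurd i.isLt (by omega)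
  unfold symmetrizer
  rw [filter_univ, sum_perm_eq_sum_swap_mul_stabilizer]
  simp only [mul_smul_comm, Finset.mul_sum, map_mul, ← Finset.smul_sum, smul_smul]
  rw [Nat.factorial_succ, Nat.cast_mul, mul_inv, Nat.cast_succ]

/-- All transpositions moving the last point agree between two copies of the symmetrizer of its
stabilizer. -/
theorem symmetrizer_mul_swap_last_mul_symmetrizer {k : ℕ} {i j : Fin (k + 1)}
    (hi : i ≠ Fin.last k) (hj : j ≠ Fin.last k) :
    symmetrizer (k + 1) k * (MonoidAlgebra.of ℚ _ (Equiv.swap i (Fin.last k)) *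
        symmetrizer (k + 1) k) =
      symmetrizer (k + 1) k * (MonoidAlgebra.of ℚ _ (Equiv.swap j (Fin.last k)) *
        symmetrizer (k + 1) k) := by
  have fix : ∀ l : Fin (k + 1), k ≤ (l : ℕ) → Equiv.swap i j l = l := by
    intro l hl
    obtain rfl : l = Fin.last k := Fin.ext (by have := l.isLt; simp; omega)
    exact Equiv.swap_apply_of_ne_of_ne hi.symm hj.symm
  have conj : Equiv.swap i (Fin.last k) =
      Equiv.swap i j * Equiv.swap j (Fin.last k) * Equiv.swap i j := by
    have h := Equiv.mul_swap_eq_swap_mul (Equiv.swap i j) j (Fin.last k)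
    rw [Equiv.swap_apply_right, fix _ le_rfl] at h
    rw [h, mul_assoc, Equiv.swap_mul_self, mul_one]
  rw [conj, map_mul, map_mul, mul_assoc, of_mul_symmetrizer fix, mul_assoc, ← mul_assoc,
    symmetrizer_mul_of fix]

/-- `S_{k+1} = (1/(k+1)) • (S_k * (1 + k • t_{k,k+1}) * S_k)` in `ℚ[S_{k+1}]`,
where `t_{k,k+1}` is the transposition of the last two points (1-based labels
`k` and `k+1`, i.e. 0-based indices `k-1` and `k`). -/
theorem symmetrizer_recursion (k : ℕ) (hk : 1 ≤ k) :
    symmetrizer (k + 1) (k + 1) =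
      ((k + 1 : ℚ))⁻¹ •
        (symmetrizer (k + 1) k *
          ((1 : MonoidAlgebra ℚ (Equiv.Perm (Fin (k + 1)))) +
            (k : ℚ) • MonoidAlgebra.of ℚ (Equiv.Perm (Fin (k + 1)))
              (Equiv.swap ⟨k - 1, by omega⟩ ⟨k, by omega⟩)) *
          symmetrizer (k + 1) k) := by
  have hne : (⟨k - 1, by omega⟩ : Fin (k + 1)) ≠ Fin.last k := by
    simp [Fin.ext_iff]
    omega
  rw [← symmetrizer_mul_symmetrizer_succ, symmetrizer_succ_eq_sum_swap_mul, mul_smul_comm,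
    Finset.mul_sum, Fin.sum_univ_castSucc, Finset.sum_congr rfl fun i _ =>
      symmetrizer_mul_swap_last_mul_symmetrizer (Fin.castSucc_lt_last i).ne hne,
    Finset.sum_const, Finset.card_univ, Fintype.card_fin, Equiv.swap_self,
    ← Equiv.Perm.one_def, map_one, one_mul, ← Nat.cast_smul_eq_nsmul ℚ, mul_assoc, add_mul,
    one_mul, mul_add, smul_mul_assoc, mul_smul_comm]
  exact congrArg _ (add_comm _ _)
end

section
/- For every k ≥ 2 and u ∈ ℂ, one has h_k(u) = trace(B⁺_k * T_1(u) * T_2(u+1) * ⋯ * T_k(u+k−1)), where B⁺_k := (1/k!) • (1 + (k−1) • P_{k−1,k}) * (1 + (k−2) • P_{k−2,k−1}) * ⋯ * (1 + 1 • P_{1,2}) in the k-leg model. -/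
/-- Matrices in the `k`-leg model over `A`: square matrices indexed by functions
`Fin k → Fin n`, a model of `End((ℂ^n)^⊗k) ⊗ A`. -/
abbrev LegMatrix (n k : ℕ) (A : Type*) := Matrix (Fin k → Fin n) (Fin k → Fin n) A

variable {n : ℕ} {A : Type*} [Ring A] [Algebra ℂ A]

/-- `T_s(v)`: the generating matrix `T(v)` placed on leg `s` of the `k`-leg model. -/
def Tleg (T : ℂ → Matrix (Fin n) (Fin n) A) {k : ℕ} (s : Fin k) (v : ℂ) :
    LegMatrix n k A := fun f g =>
  if ∀ t : Fin k, t ≠ s → f t = g t then T v (f s) (g s) else 0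

/-- The permutation matrix `P_σ` of a permutation `σ` of the legs:
its `(f,g)`-entry is `1` (via `algebraMap ℂ A`) if `f = g ∘ σ` and `0` otherwise. -/
def Pleg (n : ℕ) (A : Type*) [Ring A] [Algebra ℂ A] {k : ℕ} (σ : Equiv.Perm (Fin k)) :
    LegMatrix n k A := fun f g => if f = g ∘ σ then algebraMap ℂ A 1 else 0

/-- The transposition of legs with 1-based labels `i`, `j` (identity if out of range;
all uses are in range). -/
def legSwap (k i j : ℕ) : Equiv.Perm (Fin k) :=
  if h : 1 ≤ i ∧ i ≤ k ∧ 1 ≤ j ∧ j ≤ k then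
    Equiv.swap ⟨i - 1, by omega⟩ ⟨j - 1, by omega⟩ else 1

/-- The antisymmetrizer `A_k = (1/k!) • Σ_σ sgn(σ) • P_σ` in the `k`-leg model. -/
noncomputable def Aleg (n : ℕ) (A : Type*) [Ring A] [Algebra ℂ A] (k : ℕ) :
    LegMatrix n k A :=
  ((k.factorial : ℂ))⁻¹ •
    ∑ σ : Equiv.Perm (Fin k), ((Equiv.Perm.sign σ : ℤ) : ℂ) • Pleg n A σ

/-- The symmetrizer `S_k = (1/k!) • Σ_σ P_σ` in the `k`-leg model. -/
noncomputable def Sleg (n : ℕ) (A : Type*) [Ring A] [Algebra ℂ A] (k : ℕ) :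
    LegMatrix n k A :=
  ((k.factorial : ℂ))⁻¹ • ∑ σ : Equiv.Perm (Fin k), Pleg n A σ

/-- The ordered product `T_1(u) * T_2(u+d) * ⋯ * T_k(u+(k−1)d)` in the `k`-leg model. -/
noncomputable def TT (T : ℂ → Matrix (Fin n) (Fin n) A) (k : ℕ) (u d : ℂ) :
    LegMatrix n k A :=
  ((List.finRange k).map (fun s => Tleg T s (u + d * ((s : ℕ) : ℂ)))).prod

/-- The RTT relation of the Yangian of `gl_n`:
`((u−v) • 1 − P_{1,2}) T_1(u) T_2(v) = T_2(v) T_1(u) ((u−v) • 1 − P_{1,2})`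
in the 2-leg model. -/
def RTT (T : ℂ → Matrix (Fin n) (Fin n) A) : Prop :=
  ∀ u v : ℂ,
    ((u - v) • (1 : LegMatrix n 2 A) - Pleg n A (legSwap 2 1 2)) *
        Tleg T (0 : Fin 2) u * Tleg T (1 : Fin 2) v =
      Tleg T (1 : Fin 2) v * Tleg T (0 : Fin 2) u *
        ((u - v) • (1 : LegMatrix n 2 A) - Pleg n A (legSwap 2 1 2))

/-- The elementary symmetric function
`e_k(u) = trace(A_k * T_1(u) * T_2(u−1) * ⋯ * T_k(u−k+1))`; for `k = 0` this is `1`. -/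
noncomputable def esym (T : ℂ → Matrix (Fin n) (Fin n) A) (k : ℕ) (u : ℂ) : A :=
  Matrix.trace (Aleg n A k * TT T k u (-1))

/-- The homogeneous symmetric function
`h_k(u) = trace(S_k * T_1(u) * T_2(u+1) * ⋯ * T_k(u+k−1))`; for `k = 0` this is `1`. -/
noncomputable def hsym (T : ℂ → Matrix (Fin n) (Fin n) A) (k : ℕ) (u : ℂ) : A :=
  Matrix.trace (Sleg n A k * TT T k u 1)

/-- The power sum `p⁻_k(u) = trace(T(u) * T(u−1) * ⋯ * T(u−k+1))`,
an ordinary product of `n×n` matrices over `A`. -/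
noncomputable def pminus (T : ℂ → Matrix (Fin n) (Fin n) A) (k : ℕ) (u : ℂ) : A :=
  Matrix.trace (((List.finRange k).map (fun i => T (u - ((i : ℕ) : ℂ)))).prod)

/-- The power sum `p⁺_k(u) = trace(T(u) * T(u+1) * ⋯ * T(u+k−1))`,
an ordinary product of `n×n` matrices over `A`. -/
noncomputable def pplus (T : ℂ → Matrix (Fin n) (Fin n) A) (k : ℕ) (u : ℂ) : A :=
  Matrix.trace (((List.finRange k).map (fun i => T (u + ((i : ℕ) : ℂ)))).prod)

open Equiv (Perm swap)

section PermutationMatrices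

variable {k : ℕ}

lemma Pleg_mul_apply (σ : Perm (Fin k)) (M : LegMatrix n k A) (f g : Fin k → Fin n) :
    (Pleg n A σ * M) f g = M (f ∘ σ.symm) g := by
  rw [Matrix.mul_apply, Finset.sum_eq_single (f ∘ σ.symm)]
  · have h : f = (f ∘ σ.symm) ∘ σ := by ext t; simp
    rw [Pleg, if_pos h, map_one, one_mul]
  · intro h _ hne
    rw [Pleg, if_neg, zero_mul]
    rintro rfl
    exact hne (by ext t; simp)
  · simp

lemma mul_Pleg_apply (σ : Perm (Fin k)) (M : LegMatrix n k A) (f g : Fin k → Fin n) :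
    (M * Pleg n A σ) f g = M f (g ∘ σ) := by
  simp [Matrix.mul_apply, Pleg]

lemma Pleg_one : Pleg n A (1 : Perm (Fin k)) = 1 := by
  ext f g
  simp [Pleg, Matrix.one_apply]

lemma Pleg_mul_Pleg (σ τ : Perm (Fin k)) : Pleg n A σ * Pleg n A τ = Pleg n A (τ * σ) := by
  ext f g
  rw [mul_Pleg_apply]
  rfl

lemma trace_Pleg_mul_comm (σ : Perm (Fin k)) (M : LegMatrix n k A) :
    Matrix.trace (Pleg n A σ * M) = Matrix.trace (M * Pleg n A σ) := by
  simp only [Matrix.trace, Matrix.diag_apply, Pleg_mul_apply, mul_Pleg_apply]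
  refine Fintype.sum_equiv (σ.symm.arrowCongr (Equiv.refl _)).symm _ _ fun f => ?_
  congr 1
  ext t
  simp [Equiv.arrowCongr]

lemma Commute.Pleg_Pleg {σ τ : Perm (Fin k)} (h : Commute σ τ) :
    Commute (Pleg n A σ) (Pleg n A τ) := by
  rw [Commute, SemiconjBy, Pleg_mul_Pleg, Pleg_mul_Pleg, h.eq]

lemma Commute.Pleg_Tleg (T : ℂ → Matrix (Fin n) (Fin n) A) {σ : Perm (Fin k)} {s : Fin k}
    (hs : σ s = s) (v : ℂ) : Commute (Pleg n A σ) (Tleg T s v) := by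
  have hs' : σ.symm s = s := by rw [Equiv.symm_apply_eq, hs]
  ext f g
  rw [Pleg_mul_apply, mul_Pleg_apply]
  simp only [Tleg, Function.comp_apply, hs, hs']
  refine if_congr ⟨fun h t ht => ?_, fun h t ht => ?_⟩ rfl rfl
  · have := h (σ t) (fun e => ht (σ.injective (e.trans hs.symm)))
    simpa using this
  · have := h (σ.symm t) (fun e => ht (σ.symm.injective (e.trans hs'.symm)))
    simpa using this

end PermutationMatrices

section TwoLegs

variable {k : ℕ} {R : Type*} [Ring R]

/-- Splitting of multi-indices into the pair of indices on two distinct legs `a`, `b`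
and the indices on the remaining legs. -/
def legPairEquiv (n : ℕ) {a b : Fin k} (hab : a ≠ b) :
    (Fin k → Fin n) ≃ (Fin 2 → Fin n) × ({t : Fin k // t ≠ a ∧ t ≠ b} → Fin n) where
  toFun f := (![f a, f b], fun t => f t)
  invFun p t := if ha : t = a then p.1 0 else if hb : t = b then p.1 1 else p.2 ⟨t, ha, hb⟩
  left_inv f := by
    ext t
    by_cases ha : t = a
    · simp [ha]
    · by_cases hb : t = b
      · simp [hb, hab.symm]
      · simp [ha, hb]
  right_inv p := by
    refine Prod.ext ?_ ?_
    · ext i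
      fin_cases i <;> simp [hab.symm]
    · ext t
      simp [t.2.1, t.2.2]

/-- Placement of a two-leg matrix on the legs `a`, `b` of the `k`-leg model. -/
def legPairMatrix {a b : Fin k} (hab : a ≠ b) (M : LegMatrix n 2 R) : LegMatrix n k R :=
  (Matrix.blockDiagonal fun _ => M).submatrix (legPairEquiv n hab) (legPairEquiv n hab)

lemma legPairMatrix_apply {a b : Fin k} (hab : a ≠ b) (M : LegMatrix n 2 R)
    (f g : Fin k → Fin n) :
    legPairMatrix hab M f g =
      if ∀ t, t ≠ a → t ≠ b → f t = g t then M ![f a, f b] ![g a, g b] else 0 := by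
  simp [legPairMatrix, legPairEquiv, Matrix.blockDiagonal_apply, funext_iff]

lemma legPairMatrix_mul {a b : Fin k} (hab : a ≠ b) (M N : LegMatrix n 2 R) :
    legPairMatrix hab (M * N) = legPairMatrix hab M * legPairMatrix hab N := by
  simp only [legPairMatrix, Matrix.submatrix_mul_equiv, ← Matrix.blockDiagonal_mul]

lemma legPairMatrix_add {a b : Fin k} (hab : a ≠ b) (M N : LegMatrix n 2 R) :
    legPairMatrix hab (M + N) = legPairMatrix hab M + legPairMatrix hab N := by
  ext f g
  simp only [Matrix.add_apply, legPairMatrix_apply]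
  split_ifs <;> simp

lemma legPairMatrix_sub {a b : Fin k} (hab : a ≠ b) (M N : LegMatrix n 2 R) :
    legPairMatrix hab (M - N) = legPairMatrix hab M - legPairMatrix hab N := by
  ext f g
  simp only [Matrix.sub_apply, legPairMatrix_apply]
  split_ifs <;> simp

lemma legPairMatrix_one {a b : Fin k} (hab : a ≠ b) :
    legPairMatrix hab (1 : LegMatrix n 2 R) = 1 := by
  rw [legPairMatrix, show (fun _ => (1 : LegMatrix n 2 R)) =
    (1 : ({t : Fin k // t ≠ a ∧ t ≠ b} → Fin n) → LegMatrix n 2 R) from rfl,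
    Matrix.blockDiagonal_one, Matrix.submatrix_one_equiv]

lemma legPairMatrix_Tleg_zero (T : ℂ → Matrix (Fin n) (Fin n) R) {a b : Fin k} (hab : a ≠ b)
    (v : ℂ) : legPairMatrix hab (Tleg T 0 v) = Tleg T a v := by
  ext f g
  rw [legPairMatrix_apply, Tleg, Tleg, ← ite_and]
  refine if_congr ⟨fun ⟨h, h'⟩ t ht => ?_, fun h => ⟨fun t ha _ => h t ha, fun t ht => ?_⟩⟩
    rfl rfl
  · by_cases hb : t = b
    · simpa [hb] using h' 1 (by simp)
    · exact h t ht hb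
  · obtain rfl : t = 1 := by omega
    simpa using h b hab.symm

lemma legPairMatrix_Tleg_one (T : ℂ → Matrix (Fin n) (Fin n) R) {a b : Fin k} (hab : a ≠ b)
    (v : ℂ) : legPairMatrix hab (Tleg T 1 v) = Tleg T b v := by
  ext f g
  rw [legPairMatrix_apply, Tleg, Tleg, ← ite_and]
  refine if_congr ⟨fun ⟨h, h'⟩ t ht => ?_, fun h => ⟨fun t _ hb => h t hb, fun t ht => ?_⟩⟩
    rfl rfl
  · by_cases ha : t = a
    · simpa [ha] using h' 0 (by simp)
    · exact h t ha ht
  · obtain rfl : t = 0 := by omega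
    simpa using h a hab

lemma legPairMatrix_Pleg_swap {a b : Fin k} (hab : a ≠ b) :
    legPairMatrix hab (Pleg n A (swap 0 1)) = Pleg n A (swap a b) := by
  ext f g
  rw [legPairMatrix_apply, Pleg, Pleg, ← ite_and]
  refine if_congr ⟨fun ⟨h, h'⟩ => ?_, fun h => ⟨fun t ha hb => ?_, ?_⟩⟩ rfl rfl
  · have h0 := congrFun h' 0
    have h1 := congrFun h' 1
    simp at h0 h1
    ext t
    by_cases ha : t = a
    · simp [ha, h0]
    · by_cases hb : t = b
      · simp [hb, h1]
      · simp [Equiv.swap_apply_of_ne_of_ne ha hb, h t ha hb]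
  · rw [h, Function.comp_apply, Equiv.swap_apply_of_ne_of_ne ha hb]
  · ext i
    fin_cases i <;> simp [h]

lemma RTT.symmetrizer_mul_antisymmetrizer {T : ℂ → Matrix (Fin n) (Fin n) A} (hT : RTT T)
    {a b : Fin k} (hab : a ≠ b) (v : ℂ) :
    (1 + Pleg n A (swap a b)) * (Tleg T a v * Tleg T b (v + 1)) *
      (1 - Pleg n A (swap a b)) = 0 := by
  have hP : Pleg n A (swap (0 : Fin 2) 1) * Pleg n A (swap 0 1) = 1 := by
    rw [Pleg_mul_Pleg, Equiv.swap_mul_self, Pleg_one]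
  have h := hT v (v + 1)
  have hs : legSwap 2 1 2 = swap (0 : Fin 2) 1 := by simp [legSwap]
  rw [hs, sub_add_cancel_left, neg_one_smul] at h
  have h2 : (1 + Pleg n A (swap (0 : Fin 2) 1)) * (Tleg T 0 v * Tleg T 1 (v + 1)) =
      Tleg T 1 (v + 1) * Tleg T 0 v * (1 + Pleg n A (swap 0 1)) := by
    rw [← neg_inj, ← neg_mul, ← mul_neg, neg_add', ← mul_assoc]
    exact h
  have h3 : (1 + Pleg n A (swap (0 : Fin 2) 1)) * (Tleg T 0 v * Tleg T 1 (v + 1)) *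
      (1 - Pleg n A (swap 0 1)) = 0 := by
    rw [h2, mul_assoc, mul_sub, mul_one, add_mul, one_mul, hP,
      add_comm (Pleg n A _), sub_self, mul_zero]
  have h4 := congrArg (legPairMatrix hab) h3
  rw [legPairMatrix_mul, legPairMatrix_mul, legPairMatrix_mul, legPairMatrix_add,
    legPairMatrix_sub, legPairMatrix_one, legPairMatrix_Pleg_swap, legPairMatrix_Tleg_zero,
    legPairMatrix_Tleg_one] at h4
  rw [h4]
  ext f g
  simp [legPairMatrix_apply]

end TwoLegs

section PartialSymmetrizers

variable {k : ℕ}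

lemma List.finRange_eq_append_cons_cons (i : ℕ) (hi : i + 1 < k) :
    List.finRange k = (List.finRange k).take i ++
      (⟨i, by omega⟩ :: ⟨i + 1, hi⟩ :: (List.finRange k).drop (i + 2)) := by
  conv_lhs => rw [← List.take_append_drop i (List.finRange k)]
  rw [List.drop_eq_getElem_cons (by simp; omega), List.drop_eq_getElem_cons (by simp; omega)]
  simp

lemma RTT.symmetrizer_mul_TT_mul_Pleg {T : ℂ → Matrix (Fin n) (Fin n) A} (hT : RTT T)
    (i : ℕ) (hi : i + 1 < k) (u : ℂ) :
    (1 + Pleg n A (swap (⟨i, by omega⟩ : Fin k) ⟨i + 1, hi⟩)) * TT T k u 1 *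
        Pleg n A (swap ⟨i, by omega⟩ ⟨i + 1, hi⟩) =
      (1 + Pleg n A (swap (⟨i, by omega⟩ : Fin k) ⟨i + 1, hi⟩)) * TT T k u 1 := by
  set a : Fin k := ⟨i, by omega⟩ with ha
  set b : Fin k := ⟨i + 1, hi⟩ with hb
  have hab : a ≠ b := by simp [ha, hb]
  set P := Pleg n A (swap a b) with hP
  have hcomm (l : List (Fin k)) (hl : ∀ s ∈ l, s ≠ a ∧ s ≠ b) :
      Commute P ((l.map fun s => Tleg T s (u + 1 * ((s : ℕ) : ℂ))).prod) := by
    refine Commute.list_prod_right _ _ fun M hM => ?_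
    obtain ⟨s, hs, rfl⟩ := List.mem_map.1 hM
    exact Commute.Pleg_Tleg T (Equiv.swap_apply_of_ne_of_ne (hl s hs).1 (hl s hs).2) _
  have hsplit := List.finRange_eq_append_cons_cons i hi
  have hnodup := List.nodup_finRange k
  rw [hsplit, ← ha, ← hb] at hnodup
  have hL := hcomm ((List.finRange k).take i) (by
    intro s hs
    have := (List.nodup_append.1 hnodup).2.2 s hs
    exact ⟨this a (by simp), this b (by simp)⟩)
  have hR := hcomm ((List.finRange k).drop (i + 2)) (by
    intro s hs
    have := (List.nodup_append.1 hnodup).2.1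
    simp only [List.nodup_cons, List.mem_cons, not_or] at this
    exact ⟨fun e => this.1.2 (e ▸ hs), fun e => this.2.1 (e ▸ hs)⟩)
  have hTT : TT T k u 1 = (((List.finRange k).take i).map
        fun s => Tleg T s (u + 1 * ((s : ℕ) : ℂ))).prod *
      (Tleg T a (u + i) * Tleg T b (u + i + 1)) *
      (((List.finRange k).drop (i + 2)).map
        fun s => Tleg T s (u + 1 * ((s : ℕ) : ℂ))).prod := by
    rw [TT]
    conv_lhs => rw [hsplit]
    simp only [List.map_append, List.prod_append, List.map_cons, List.prod_cons, mul_assoc]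
    simp [ha, hb, add_assoc]
  have key := hT.symmetrizer_mul_antisymmetrizer hab (u + i)
  rw [← hP] at key
  rw [← sub_eq_zero, ← neg_eq_zero, neg_sub, ← mul_one_sub, hTT]
  set L := (((List.finRange k).take i).map fun s => Tleg T s (u + 1 * ((s : ℕ) : ℂ))).prod
  set R := (((List.finRange k).drop (i + 2)).map fun s => Tleg T s (u + 1 * ((s : ℕ) : ℂ))).prod
  set M := Tleg T a (u + i) * Tleg T b (u + i + 1)
  have hL' : (1 + P) * L = L * (1 + P) := ((Commute.one_left L).add_left hL).eq
  have hR' : (1 - P) * R = R * (1 - P) := ((Commute.one_left R).sub_left hR).eq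
  calc (1 + P) * (L * M * R) * (1 - P) = ((1 + P) * L) * M * (R * (1 - P)) := by
        simp only [mul_assoc]
    _ = L * ((1 + P) * M * (1 - P)) * R := by
        rw [hL', ← hR']; simp only [mul_assoc]
    _ = 0 := by rw [key, mul_zero, zero_mul]

/-- The permutations of the legs that fix every leg of (0-based) index at least `j`. -/
def initialPerms (k j : ℕ) : Finset (Perm (Fin k)) :=
  Finset.univ.filter fun σ => ∀ t : Fin k, j ≤ t → σ t = t

lemma mem_initialPerms {j : ℕ} {σ : Perm (Fin k)} :
    σ ∈ initialPerms k j ↔ ∀ t : Fin k, j ≤ t → σ t = t := by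
  simp [initialPerms]

lemma mul_mem_initialPerms {j : ℕ} {σ τ : Perm (Fin k)} (hσ : σ ∈ initialPerms k j)
    (hτ : τ ∈ initialPerms k j) : σ * τ ∈ initialPerms k j := by
  rw [mem_initialPerms] at *
  intro t ht
  rw [Equiv.Perm.mul_apply, hτ t ht, hσ t ht]

lemma swap_mem_initialPerms {j : ℕ} {a b : Fin k} (ha : (a : ℕ) < j) (hb : (b : ℕ) < j) :
    swap a b ∈ initialPerms k j := by
  rw [mem_initialPerms]
  intro t ht
  exact Equiv.swap_apply_of_ne_of_ne (by rintro rfl; omega) (by rintro rfl; omega)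

/-- The sum of `P_σ` over the permutations `σ` of the first `j` legs. -/
def partialSymmetrizer (n : ℕ) (A : Type*) [Ring A] [Algebra ℂ A] (k j : ℕ) :
    LegMatrix n k A :=
  ∑ σ ∈ initialPerms k j, Pleg n A σ

lemma partialSymmetrizer_self :
    partialSymmetrizer n A k k = ∑ σ : Perm (Fin k), Pleg n A σ := by
  rw [partialSymmetrizer, initialPerms, Finset.filter_true_of_mem]
  intro σ _ t ht
  exact absurd t.2 (by omega)

lemma partialSymmetrizer_one : partialSymmetrizer n A k 1 = 1 := by
  have h : initialPerms k 1 = {1} := by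
    ext σ
    rw [mem_initialPerms, Finset.mem_singleton]
    refine ⟨fun h => ?_, fun h => by simp [h]⟩
    ext t
    by_cases ht : 1 ≤ (t : ℕ)
    · simp [h t ht]
    · by_cases hs : 1 ≤ (σ t : ℕ)
      · rw [σ.injective (h (σ t) hs)]
        simp
      · simp only [Equiv.Perm.one_apply]
        omega
  rw [partialSymmetrizer, h, Finset.sum_singleton, Pleg_one]

lemma Pleg_swap_mul_partialSymmetrizer {j : ℕ} {a b : Fin k} (ha : (a : ℕ) < j)
    (hb : (b : ℕ) < j) :
    Pleg n A (swap a b) * partialSymmetrizer n A k j = partialSymmetrizer n A k j := by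
  rw [partialSymmetrizer, Finset.mul_sum]
  refine Finset.sum_nbij' (· * swap a b) (· * swap a b)
    (fun σ hσ => mul_mem_initialPerms hσ (swap_mem_initialPerms ha hb))
    (fun σ hσ => mul_mem_initialPerms hσ (swap_mem_initialPerms ha hb))
    (fun σ _ => by simp [mul_assoc]) (fun σ _ => by simp [mul_assoc])
    (fun σ _ => Pleg_mul_Pleg _ _)

lemma partialSymmetrizer_mul_Pleg_swap {j : ℕ} {a b : Fin k} (ha : (a : ℕ) < j)
    (hb : (b : ℕ) < j) :
    partialSymmetrizer n A k j * Pleg n A (swap a b) = partialSymmetrizer n A k j := by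
  rw [partialSymmetrizer, Finset.sum_mul]
  refine Finset.sum_nbij' (swap a b * ·) (swap a b * ·)
    (fun σ hσ => mul_mem_initialPerms (swap_mem_initialPerms ha hb) hσ)
    (fun σ hσ => mul_mem_initialPerms (swap_mem_initialPerms ha hb) hσ)
    (fun σ _ => by simp) (fun σ _ => by simp)
    (fun σ _ => Pleg_mul_Pleg _ _)

lemma partialSymmetrizer_succ {j : ℕ} (hj : j < k) :
    partialSymmetrizer n A k (j + 1) =
      ∑ i : Fin (j + 1), Pleg n A (swap (Fin.castLE hj i) ⟨j, hj⟩) *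
        partialSymmetrizer n A k j := by
  simp only [partialSymmetrizer, Finset.mul_sum]
  rw [← Finset.sum_product', eq_comm]
  have hinv {σ : Perm (Fin k)} (hσ : σ ∈ initialPerms k (j + 1)) :
      (σ.symm ⟨j, hj⟩ : ℕ) < j + 1 := by
    by_contra hlt
    have h1 := mem_initialPerms.1 hσ (σ.symm ⟨j, hj⟩) (by omega)
    rw [Equiv.apply_symm_apply] at h1
    rw [← h1] at hlt
    simp at hlt
  refine Finset.sum_bij (fun p _ => p.2 * swap (Fin.castLE hj p.1) ⟨j, hj⟩) ?_ ?_ ?_ ?_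
  · rintro ⟨i, σ⟩ hp
    have hσ := (Finset.mem_product.1 hp).2
    refine mul_mem_initialPerms ?_ (swap_mem_initialPerms i.2 (Nat.lt_succ_self j))
    rw [mem_initialPerms] at hσ ⊢
    exact fun t ht => hσ t (by omega)
  · rintro ⟨i, σ⟩ hp ⟨i', σ'⟩ hp' h
    have hσ := mem_initialPerms.1 (Finset.mem_product.1 hp).2 ⟨j, hj⟩ le_rfl
    have hσ' := mem_initialPerms.1 (Finset.mem_product.1 hp').2 ⟨j, hj⟩ le_rfl
    simp only at h hσ hσ'
    have hi : Fin.castLE hj i = Fin.castLE hj i' := by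
      apply (σ * swap (Fin.castLE hj i) ⟨j, hj⟩).injective
      conv_rhs => rw [h]
      simp [hσ, hσ']
    have hii : i = i' := Fin.castLE_injective hj hi
    subst hii
    rw [mul_right_cancel h]
  · intro σ hσ
    refine ⟨(⟨σ.symm ⟨j, hj⟩, hinv hσ⟩, σ * swap (σ.symm ⟨j, hj⟩) ⟨j, hj⟩), ?_, ?_⟩
    · rw [Finset.mem_product]
      refine ⟨Finset.mem_univ _, mem_initialPerms.2 fun t ht => ?_⟩
      by_cases htj : t = ⟨j, hj⟩
      · simp [htj]
      · have hlt : j + 1 ≤ (t : ℕ) := by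
          have : (t : ℕ) ≠ j := fun e => htj (Fin.ext e)
          omega
        have hne : t ≠ σ.symm ⟨j, hj⟩ := by
          intro e
          have := hinv hσ
          rw [← e] at this
          omega
        rw [Equiv.Perm.mul_apply, Equiv.swap_apply_of_ne_of_ne hne htj]
        exact mem_initialPerms.1 hσ t hlt
    · simp [mul_assoc]
  · rintro ⟨i, σ⟩ _
    exact Pleg_mul_Pleg _ _

lemma RTT.partialSymmetrizer_mul_TT_mul_Pleg {T : ℂ → Matrix (Fin n) (Fin n) A} (hT : RTT T)
    (u : ℂ) {j : ℕ} (hj : j ≤ k) {a b : Fin k} (hab : a < b) (hb : (b : ℕ) < j) :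
    partialSymmetrizer n A k j * TT T k u 1 * Pleg n A (swap a b) =
      partialSymmetrizer n A k j * TT T k u 1 := by
  have hadj (i : ℕ) (hi : i + 1 < j) :
      partialSymmetrizer n A k j * TT T k u 1 *
        Pleg n A (swap (⟨i, by omega⟩ : Fin k) ⟨i + 1, by omega⟩) =
      partialSymmetrizer n A k j * TT T k u 1 := by
    have h := congrArg (partialSymmetrizer n A k j * ·)
      (hT.symmetrizer_mul_TT_mul_Pleg i (by omega : i + 1 < k) u)
    simp only [← mul_assoc, mul_add, mul_one] at h
    rw [partialSymmetrizer_mul_Pleg_swap (by simp; omega) (by simpa using hi), ← two_smul ℂ,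
      smul_mul_assoc, smul_mul_assoc] at h
    exact smul_right_injective _ (two_ne_zero (α := ℂ)) h
  obtain ⟨a, ha⟩ := a
  obtain ⟨b, hbk⟩ := b
  simp only [Fin.mk_lt_mk] at hab hb
  induction b, hab using Nat.le_induction with
  | base => exact hadj a hb
  | succ b hab ih =>
    have ih' := ih (by omega) (by omega) hadj
    have hconj : swap (⟨a, ha⟩ : Fin k) ⟨b + 1, hbk⟩ =
        swap ⟨b, by omega⟩ ⟨b + 1, hbk⟩ * swap ⟨a, ha⟩ ⟨b, by omega⟩ *
          swap ⟨b, by omega⟩ ⟨b + 1, hbk⟩ := by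
      rw [Equiv.swap_mul_swap_mul_swap (by simp; omega) (by simp; omega), Equiv.swap_comm]
    rw [hconj, ← Pleg_mul_Pleg, ← Pleg_mul_Pleg, ← mul_assoc, ← mul_assoc, hadj b hb, ih',
      hadj b hb]

lemma RTT.trace_mul_partialSymmetrizer_succ_mul_TT {T : ℂ → Matrix (Fin n) (Fin n) A}
    (hT : RTT T) (u : ℂ) {j : ℕ} (hj : j + 1 < k) (X : LegMatrix n k A)
    (hX : ∀ σ ∈ initialPerms k (j + 1), Commute (Pleg n A σ) X) :
    Matrix.trace (X * (partialSymmetrizer n A k (j + 2) * TT T k u 1)) =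
      Matrix.trace (X * (1 + ((j + 1 : ℕ) : ℂ) •
        Pleg n A (swap (⟨j, by omega⟩ : Fin k) ⟨j + 1, hj⟩)) *
          (partialSymmetrizer n A k (j + 1) * TT T k u 1)) := by
  set Y := partialSymmetrizer n A k (j + 1) * TT T k u 1 with hY
  have hterm (i : Fin (j + 1)) :
      Matrix.trace (X * (Pleg n A (swap (Fin.castLE hj (Fin.castSucc i)) ⟨j + 1, hj⟩) * Y)) =
        Matrix.trace (X * (Pleg n A (swap (⟨j, by omega⟩ : Fin k) ⟨j + 1, hj⟩) * Y)) := by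
    rcases (Nat.lt_succ_iff.1 i.2).eq_or_lt with hi | hi
    · have : Fin.castLE hj (Fin.castSucc i) = ⟨j, by omega⟩ := Fin.ext hi
      rw [this]
    · set a : Fin k := Fin.castLE hj (Fin.castSucc i) with ha
      set b : Fin k := ⟨j, by omega⟩ with hb
      set c : Fin k := ⟨j + 1, hj⟩ with hc
      have hconj : swap a c = swap a b * swap b c * swap a b := by
        rw [Equiv.swap_comm b c, Equiv.swap_comm a b, Equiv.swap_mul_swap_mul_swap]
        · simp [hb, hc]
        · exact (Fin.mk_lt_mk.2 (by omega : (i : ℕ) < j + 1)).ne'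
      have hY1 : Pleg n A (swap a b) * Y = Y := by
        rw [hY, ← mul_assoc, Pleg_swap_mul_partialSymmetrizer (by simp [ha]; omega)
          (by simp [hb])]
      have hY2 : Y * Pleg n A (swap a b) = Y :=
        hT.partialSymmetrizer_mul_TT_mul_Pleg u (by omega) (Fin.mk_lt_mk.2 hi) (by simp [hb])
      have hcX := (hX (swap a b) (swap_mem_initialPerms (by simp [ha]; omega)
        (by simp [hb]))).eq
      rw [hconj, ← Pleg_mul_Pleg, ← Pleg_mul_Pleg, mul_assoc, mul_assoc, hY1, ← mul_assoc X,
        ← hcX, mul_assoc, trace_Pleg_mul_comm]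
      simp only [mul_assoc, hY2]
  rw [partialSymmetrizer_succ hj, ← Finset.sum_mul, mul_assoc, ← hY, Finset.sum_mul,
    Finset.mul_sum, Matrix.trace_sum, Fin.sum_univ_castSucc, Finset.sum_congr rfl
    fun i _ => hterm i]
  have hlast : Fin.castLE hj (Fin.last (j + 1)) = ⟨j + 1, hj⟩ := rfl
  rw [hlast, Equiv.swap_self, ← Equiv.Perm.one_def, Pleg_one, Finset.sum_const,
    Finset.card_univ, Fintype.card_fin, mul_add, mul_one, add_mul, Matrix.trace_add, one_mul,
    add_comm, mul_smul_comm, smul_mul_assoc, Matrix.trace_smul, mul_assoc, Nat.cast_smul_eq_nsmul]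

end PartialSymmetrizers

lemma legSwap_succ {k i : ℕ} (hi : i + 1 < k) :
    legSwap k (i + 1) (i + 2) = swap ⟨i, by omega⟩ ⟨i + 1, hi⟩ := by
  rw [legSwap, dif_pos (by omega)]
  rfl

lemma RTT.trace_partialSymmetrizer_mul_TT {T : ℂ → Matrix (Fin n) (Fin n) A} (hT : RTT T)
    (u : ℂ) {k r : ℕ} (hr : r + 1 ≤ k) :
    Matrix.trace (partialSymmetrizer n A k k * TT T k u 1) =
      Matrix.trace (((List.range r).map (fun m =>
          (1 : LegMatrix n k A) +
            ((k - 1 - m : ℕ) : ℂ) • Pleg n A (legSwap k (k - 1 - m) (k - m)))).prod *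
        (partialSymmetrizer n A k (k - r) * TT T k u 1)) := by
  induction r with
  | zero => simp
  | succ r ih =>
    obtain ⟨j, rfl⟩ : ∃ j, k = j + 2 + r := ⟨k - 2 - r, by omega⟩
    rw [ih (by omega), List.range_succ, List.map_append, List.prod_append, List.map_singleton,
      List.prod_singleton, show j + 2 + r - r = j + 2 by omega,
      show j + 2 + r - 1 - r = j + 1 by omega, show j + 2 + r - (r + 1) = j + 1 by omega,
      legSwap_succ (by omega)]
    refine hT.trace_mul_partialSymmetrizer_succ_mul_TT u (by omega) _ fun σ hσ => ?_
    refine Commute.list_prod_right _ _ fun M hM => ?_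
    obtain ⟨m, hm, rfl⟩ := List.mem_map.1 hM
    rw [List.mem_range] at hm
    obtain ⟨i, hi⟩ : ∃ i, j + 2 + r - m = i + 2 := ⟨j + r - m, by omega⟩
    rw [hi, show j + 2 + r - 1 - m = i + 1 by omega, legSwap_succ (by omega)]
    refine (Commute.one_right _).add_right (Commute.smul_right (Commute.Pleg_Pleg ?_) _)
    rw [mem_initialPerms] at hσ
    rw [Commute, SemiconjBy, Equiv.mul_swap_eq_swap_mul, hσ _ (by simp; omega),
      hσ _ (by simp; omega)]

/-- `h_k(u) = trace(B⁺_k T_1(u) ⋯ T_k(u+k−1))` where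
`B⁺_k = (1/k!) • (1 + (k−1) • P_{k−1,k}) ⋯ (1 + 1 • P_{1,2})`
(the `m`-th factor, `m = 0, …, k−2`, being `1 + (k−1−m) • P_{k−1−m,k−m}`). -/
theorem hsym_eq_trace_Bplus (hn : 1 ≤ n) (T : ℂ → Matrix (Fin n) (Fin n) A)
    (hT : RTT T) (k : ℕ) (hk : 2 ≤ k) (u : ℂ) :
    hsym T k u =
      Matrix.trace
        ((((k.factorial : ℂ))⁻¹ •
            ((List.range (k - 1)).map (fun m =>
              (1 : LegMatrix n k A) +
                ((k - 1 - m : ℕ) : ℂ) • Pleg n A (legSwap k (k - 1 - m) (k - m)))).prod) *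
          TT T k u 1) := by
  have h := hT.trace_partialSymmetrizer_mul_TT u (r := k - 1) (k := k) (by omega)
  rw [show k - (k - 1) = 1 by omega, partialSymmetrizer_one, one_mul,
    partialSymmetrizer_self] at h
  rw [hsym, Sleg, smul_mul_assoc, smul_mul_assoc, Matrix.trace_smul, Matrix.trace_smul, h]
end
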